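/- arXiv:1602.07328 — 3 statements merged into one kernel-verified Lean document; each statement's English description precedes it below -/
import Mathlib

section
/- Let C be an abelian category and (X,ω) a pair of classes of objects of C such that X is closed under extensions, the zero object belongs to X, ω is a relative cogenerator in X, and ω is X-injective. Then for any object C' of C with resdim_X(C') = n < ∞ there exist short exact sequences 0 → K → X --φ--> C' → 0 and 0 → C' --φ'--> H → X' → 0 with X, X' ∈ X, resdim_ω(K) = n − 1 (where resdim_ω(K) = −1 means K = 0), and resdim_ω(H) ≤ n, such that φ is an X-precover of C' with K ∈ X^⊥, and φ' is an ω^∧-preenvelope of C' with X' ∈ ^⊥(ω^∧). -/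
/-!
Common definitions for Auslander–Buchweitz approximation theory in abelian
categories, following Becerril–Mendoza–Pérez–Santiago.
-/

open CategoryTheory CategoryTheory.Limits ZeroObject

universe w v u

namespace ABFormal

variable {C : Type u} [Category.{v} C] [Abelian C] [CategoryTheory.HasExt.{w} C]

/-- `0 → A → B → C' → 0` is a short exact sequence in `C`. -/
def IsShortExactSeq {A B C' : C} (f : A ⟶ B) (g : B ⟶ C') : Prop :=
  ∃ w : f ≫ g = 0, (ShortComplex.mk f g w).ShortExact

/-- `ωω` is `XX`-injective: `Ext^i(X, W) = 0` for all `X ∈ XX`, `W ∈ ωω` and `i > 0`. -/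
def IsRelInjective (XX ωω : Set C) : Prop :=
  ∀ W ∈ ωω, ∀ X ∈ XX, ∀ i : ℕ, 0 < i → Subsingleton (Abelian.Ext.{w} X W i)

/-- `ωω` is `XX`-projective: `Ext^i(W, X) = 0` for all `X ∈ XX`, `W ∈ ωω` and `i > 0`. -/
def IsRelProjective (XX ωω : Set C) : Prop :=
  ∀ W ∈ ωω, ∀ X ∈ XX, ∀ i : ℕ, 0 < i → Subsingleton (Abelian.Ext.{w} W X i)

/-- `ωω` is a relative cogenerator in `XX`. -/
def IsRelCogenerator (XX ωω : Set C) : Prop :=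
  ωω ⊆ XX ∧ ∀ X ∈ XX, ∃ (W X' : C) (i : X ⟶ W) (p : W ⟶ X'),
    W ∈ ωω ∧ X' ∈ XX ∧ IsShortExactSeq i p

/-- `ωω` is a relative generator in `XX`. -/
def IsRelGenerator (XX ωω : Set C) : Prop :=
  ωω ⊆ XX ∧ ∀ X ∈ XX, ∃ (X' W : C) (i : X' ⟶ W) (p : W ⟶ X),
    W ∈ ωω ∧ X' ∈ XX ∧ IsShortExactSeq i p

/-- `id_XX(M) ≤ n` : `Ext^j(X, M) = 0` for all `X ∈ XX` and `j > n`. -/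
def relInjDimLE (XX : Set C) (M : C) (n : ℕ) : Prop :=
  ∀ X ∈ XX, ∀ j : ℕ, n < j → Subsingleton (Abelian.Ext.{w} X M j)

/-- The relative injective dimension `id_XX(M) : ℕ∞`. -/
noncomputable def relInjDim (XX : Set C) (M : C) : ℕ∞ :=
  sInf {m : ℕ∞ | ∃ n : ℕ, m = (n : ℕ∞) ∧ relInjDimLE XX M n}

/-- `pd_XX(M) ≤ n` : `Ext^j(M, X) = 0` for all `X ∈ XX` and `j > n`. -/
def relProjDimLE (XX : Set C) (M : C) (n : ℕ) : Prop :=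
  ∀ X ∈ XX, ∀ j : ℕ, n < j → Subsingleton (Abelian.Ext.{w} M X j)

/-- The relative projective dimension `pd_XX(M) : ℕ∞`. -/
noncomputable def relProjDim (XX : Set C) (M : C) : ℕ∞ :=
  sInf {m : ℕ∞ | ∃ n : ℕ, m = (n : ℕ∞) ∧ relProjDimLE XX M n}

/-- There is an exact sequence `0 → X_n → ⋯ → X_0 → M → 0` with all `X_i ∈ XX`
(a resolution of length `n`). -/
inductive HasResolutionLength (XX : Set C) : ℕ → C → Prop
  | zero {M X : C} (hX : X ∈ XX) (e : X ≅ M) : HasResolutionLength XX 0 M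
  | succ {n : ℕ} {M : C} (K X : C) (hX : X ∈ XX)
      (i : K ⟶ X) (p : X ⟶ M) (hse : IsShortExactSeq i p)
      (hK : HasResolutionLength XX n K) : HasResolutionLength XX (n + 1) M

/-- The `XX`-resolution dimension `resdim_XX(M) : ℕ∞`. -/
noncomputable def resDim (XX : Set C) (M : C) : ℕ∞ :=
  sInf {m : ℕ∞ | ∃ n : ℕ, m = (n : ℕ∞) ∧ HasResolutionLength XX n M}

/-- `XX^∧`, the class of objects with a finite `XX`-resolution. -/
def resHat (XX : Set C) : Set C :=
  {M | ∃ n : ℕ, HasResolutionLength XX n M}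

/-- There is an exact sequence `0 → M → X^0 → ⋯ → X^n → 0` with all `X^i ∈ XX`
(a coresolution of length `n`). -/
inductive HasCoresolutionLength (XX : Set C) : ℕ → C → Prop
  | zero {M X : C} (hX : X ∈ XX) (e : M ≅ X) : HasCoresolutionLength XX 0 M
  | succ {n : ℕ} {M : C} (X Q : C) (hX : X ∈ XX)
      (i : M ⟶ X) (p : X ⟶ Q) (hse : IsShortExactSeq i p)
      (hQ : HasCoresolutionLength XX n Q) : HasCoresolutionLength XX (n + 1) M

/-- The `XX`-coresolution dimension `coresdim_XX(M) : ℕ∞`. -/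
noncomputable def coresDim (XX : Set C) (M : C) : ℕ∞ :=
  sInf {m : ℕ∞ | ∃ n : ℕ, m = (n : ℕ∞) ∧ HasCoresolutionLength XX n M}

/-- `XX^∨`, the class of objects with a finite `XX`-coresolution. -/
def coresVee (XX : Set C) : Set C :=
  {M | ∃ n : ℕ, HasCoresolutionLength XX n M}

/-- `IsSyzygyOf XX n M K` : there is an exact sequence
`0 → K → X_{n-1} → ⋯ → X_0 → M → 0` with all `X_i ∈ XX`. -/
inductive IsSyzygyOf (XX : Set C) : ℕ → C → C → Prop
  | zero {M K : C} (e : K ≅ M) : IsSyzygyOf XX 0 M K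
  | succ {n : ℕ} {M : C} (K X L : C) (hX : X ∈ XX)
      (i : K ⟶ X) (p : X ⟶ L) (hse : IsShortExactSeq i p)
      (hL : IsSyzygyOf XX n M L) : IsSyzygyOf XX (n + 1) M K

/-- `XX^⊥ = {N | Ext^i(X, N) = 0 for all X ∈ XX, i > 0}`. -/
def rightPerp (XX : Set C) : Set C :=
  {N | ∀ X ∈ XX, ∀ i : ℕ, 0 < i → Subsingleton (Abelian.Ext.{w} X N i)}

/-- `XX^{⊥₁} = {N | Ext^1(X, N) = 0 for all X ∈ XX}`. -/
def rightPerp1 (XX : Set C) : Set C :=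
  {N | ∀ X ∈ XX, Subsingleton (Abelian.Ext.{w} X N 1)}

/-- `^⊥XX = {N | Ext^i(N, X) = 0 for all X ∈ XX, i > 0}`. -/
def leftPerp (XX : Set C) : Set C :=
  {N | ∀ X ∈ XX, ∀ i : ℕ, 0 < i → Subsingleton (Abelian.Ext.{w} N X i)}

/-- `^{⊥₁}XX = {N | Ext^1(N, X) = 0 for all X ∈ XX}`. -/
def leftPerp1 (XX : Set C) : Set C :=
  {N | ∀ X ∈ XX, Subsingleton (Abelian.Ext.{w} N X 1)}

/-- Closed under extensions. -/
def ClosedUnderExtensions (XX : Set C) : Prop :=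
  ∀ ⦃A B C' : C⦄ (f : A ⟶ B) (g : B ⟶ C'), IsShortExactSeq f g →
    A ∈ XX → C' ∈ XX → B ∈ XX

/-- Closed under kernels of epimorphisms between objects of the class. -/
def ClosedUnderKernelsOfEpis (XX : Set C) : Prop :=
  ∀ ⦃A B C' : C⦄ (f : A ⟶ B) (g : B ⟶ C'), IsShortExactSeq f g →
    B ∈ XX → C' ∈ XX → A ∈ XX

/-- Closed under cokernels of monomorphisms between objects of the class. -/
def ClosedUnderCokernelsOfMonos (XX : Set C) : Prop :=
  ∀ ⦃A B C' : C⦄ (f : A ⟶ B) (g : B ⟶ C'), IsShortExactSeq f g →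
    A ∈ XX → B ∈ XX → C' ∈ XX

/-- Closed under direct summands (retracts) in `C`. -/
def ClosedUnderSummands (XX : Set C) : Prop :=
  ∀ ⦃X A : C⦄, X ∈ XX → ∀ (s : A ⟶ X) (r : X ⟶ A), s ≫ r = 𝟙 A → A ∈ XX

/-- Pre-resolving class: closed under extensions and kernels of epimorphisms. -/
def IsPreresolving (XX : Set C) : Prop :=
  ClosedUnderExtensions XX ∧ ClosedUnderKernelsOfEpis XX

/-- Pre-coresolving class: closed under extensions and cokernels of monomorphisms. -/
def IsPrecoresolving (XX : Set C) : Prop :=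
  ClosedUnderExtensions XX ∧ ClosedUnderCokernelsOfMonos XX

/-- Left thick class. -/
def IsLeftThick (XX : Set C) : Prop :=
  IsPreresolving XX ∧ ClosedUnderSummands XX

/-- Right thick class. -/
def IsRightThick (XX : Set C) : Prop :=
  IsPrecoresolving XX ∧ ClosedUnderSummands XX

/-- Thick class. -/
def IsThickClass (XX : Set C) : Prop :=
  IsLeftThick XX ∧ IsRightThick XX

/-- The smallest thick class of `C` containing `S`. -/
def thickClosure (S : Set C) : Set C :=
  ⋂₀ {T : Set C | IsThickClass T ∧ S ⊆ T}

/-- The class of projective objects of `C`. -/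
def ProjClass (C : Type u) [Category.{v} C] : Set C := {P | Projective P}

/-- The class of injective objects of `C`. -/
def InjClass (C : Type u) [Category.{v} C] : Set C := {I | Injective I}

/-- Resolving class in `C`: pre-resolving and containing all projectives. -/
def IsResolvingClass (XX : Set C) : Prop :=
  IsPreresolving XX ∧ ProjClass C ⊆ XX

/-- Coresolving class in `C`: pre-coresolving and containing all injectives. -/
def IsCoresolvingClass (XX : Set C) : Prop :=
  IsPrecoresolving XX ∧ InjClass C ⊆ XX

/-- A left Frobenius pair `(XX, ωω)` in `C`. -/
structure LeftFrobeniusPair (XX ωω : Set C) : Prop where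
  leftThick : IsLeftThick XX
  relInj : IsRelInjective XX ωω
  relCogen : IsRelCogenerator XX ωω
  summands : ClosedUnderSummands ωω

/-- A strong left Frobenius pair `(XX, ωω)` in `C`. -/
structure StrongLeftFrobeniusPair (XX ωω : Set C) extends LeftFrobeniusPair XX ωω : Prop where
  relProj : IsRelProjective XX ωω
  relGen : IsRelGenerator XX ωω

/-- A right Frobenius pair `(νν, YY)` in `C`. -/
structure RightFrobeniusPair (νν YY : Set C) : Prop where
  rightThick : IsRightThick YY
  relProj : IsRelProjective YY νν
  relGen : IsRelGenerator YY νν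
  summands : ClosedUnderSummands νν

/-- `φ : X ⟶ M` is an `XX`-precover of `M`. -/
def IsPrecover (XX : Set C) {X M : C} (φ : X ⟶ M) : Prop :=
  X ∈ XX ∧ ∀ (X' : C), X' ∈ XX → ∀ f : X' ⟶ M, ∃ h : X' ⟶ X, h ≫ φ = f

/-- `φ : M ⟶ Y` is an `XX`-preenvelope of `M`. -/
def IsPreenvelope (XX : Set C) {M Y : C} (φ : M ⟶ Y) : Prop :=
  Y ∈ XX ∧ ∀ (Y' : C), Y' ∈ XX → ∀ f : M ⟶ Y', ∃ h : Y ⟶ Y', φ ≫ h = f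

/-- A left `S`-cotorsion pair `(F, G)` in `C`. -/
def IsLeftCotorsionPair (S F G : Set C) : Prop :=
  F ⊆ S ∧ G ⊆ S ∧
  F = {A | A ∈ S ∧ ∀ G' ∈ G, Subsingleton (Abelian.Ext.{w} A G' 1)} ∧
  ∀ s ∈ S, ∃ (G' F' : C) (i : G' ⟶ F') (p : F' ⟶ s),
    G' ∈ G ∧ F' ∈ F ∧ IsShortExactSeq i p

/-- A right `S`-cotorsion pair `(F, G)` in `C`. -/
def IsRightCotorsionPair (S F G : Set C) : Prop :=
  F ⊆ S ∧ G ⊆ S ∧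
  G = {A | A ∈ S ∧ ∀ F' ∈ F, Subsingleton (Abelian.Ext.{w} F' A 1)} ∧
  ∀ s ∈ S, ∃ (G' F' : C) (i : s ⟶ G') (p : G' ⟶ F'),
    G' ∈ G ∧ F' ∈ F ∧ IsShortExactSeq i p

/-- An `S`-cotorsion pair `(F, G)` in `C`. -/
def IsCotorsionPair (S F G : Set C) : Prop :=
  IsLeftCotorsionPair S F G ∧ IsRightCotorsionPair S F G

/-- A left weak AB context `(AA, BB)` in `C`. -/
structure LeftWeakABContext (AA BB : Set C) : Prop where
  frob : LeftFrobeniusPair AA (AA ∩ BB)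
  rightThick : IsRightThick BB
  sub : BB ⊆ resHat AA

omit [HasExt.{w} C] in
/-- A monomorphism together with a cokernel of it forms a short exact sequence. -/
theorem isShortExactSeq_of_desc {A B D : C} {f : A ⟶ B} {g : B ⟶ D} [Mono f] [Epi g]
    (w : f ≫ g = 0) (h : ∀ {T : C} (k : B ⟶ T), f ≫ k = 0 → ∃ l : D ⟶ T, g ≫ l = k) :
    IsShortExactSeq f g :=
  ⟨w, { exact := ShortComplex.exact_of_g_is_cokernel _
          (CokernelCofork.IsColimit.ofπ' g w fun k hk => ⟨_, (h k hk).choose_spec⟩)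
        mono_f := ‹Mono f›
        epi_g := ‹Epi g› }⟩

omit [HasExt.{w} C] in
theorem IsShortExactSeq.exists_desc {A B D T : C} {f : A ⟶ B} {g : B ⟶ D}
    (h : IsShortExactSeq f g) (k : B ⟶ T) (hk : f ≫ k = 0) : ∃ l : D ⟶ T, g ≫ l = k := by
  obtain ⟨w, h⟩ := h
  have := h.epi_g
  exact ⟨h.exact.desc k hk, h.exact.g_desc k hk⟩

omit [HasExt.{w} C] in
/-- The pushout of a short exact sequence along a morphism out of its left term. -/
theorem IsShortExactSeq.exists_of_isPushout {A B D A' P : C} {f : A ⟶ B} {g : B ⟶ D}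
    (h : IsShortExactSeq f g) {a : A ⟶ A'} {b : B ⟶ P} {f' : A' ⟶ P}
    (sq : IsPushout f a b f') : ∃ g' : P ⟶ D, IsShortExactSeq f' g' ∧ b ≫ g' = g := by
  have : Mono f := h.choose_spec.mono_f
  have : Epi g := h.choose_spec.epi_g
  have : Mono f' := (MorphismProperty.monomorphisms C).of_isPushout sq.flip ‹Mono f›
  have hw : f ≫ g = a ≫ 0 := by rw [h.choose, comp_zero]
  have hb : b ≫ sq.desc g 0 hw = g := sq.inl_desc _ _ _
  have hf' : f' ≫ sq.desc g 0 hw = 0 := sq.inr_desc _ _ _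
  have : Epi (sq.desc g 0 hw) := epi_of_epi_fac hb
  refine ⟨sq.desc g 0 hw, isShortExactSeq_of_desc hf' fun k hk => ?_, hb⟩
  obtain ⟨l, hl⟩ := h.exists_desc (b ≫ k) (by rw [sq.w_assoc, hk, comp_zero])
  refine ⟨l, sq.hom_ext ?_ ?_⟩
  · rw [reassoc_of% hb, hl]
  · rw [reassoc_of% hf', zero_comp, hk]

omit [HasExt.{w} C] in
/-- In a pushout of an epimorphism `e` along a monomorphism `u`, the kernel of `e` is also the
kernel of the morphism parallel to `e`. -/
theorem IsShortExactSeq.comp_of_isPushout {A E D W P : C} {k : A ⟶ E} {e : E ⟶ D}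
    (h : IsShortExactSeq k e) {u : E ⟶ W} [Mono u] {c : W ⟶ P} {d : D ⟶ P}
    (sq : IsPushout u e c d) : IsShortExactSeq (k ≫ u) c := by
  have : Mono k := h.choose_spec.mono_f
  have : Epi e := h.choose_spec.epi_g
  have : Epi c := (MorphismProperty.epimorphisms C).of_isPushout sq ‹Epi e›
  refine isShortExactSeq_of_desc (by rw [Category.assoc, sq.w, ← Category.assoc, h.choose,
    zero_comp]) fun t ht => ?_
  obtain ⟨l, hl⟩ := h.exists_desc (u ≫ t) (by rw [← Category.assoc, ht])
  exact ⟨sq.desc t l hl.symm, sq.inl_desc _ _ _⟩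

omit [HasExt.{w} C] in
theorem isShortExactSeq_zero_iso {A B : C} (e : A ≅ B) {Z : C} (hZ : IsZero Z) :
    IsShortExactSeq (0 : Z ⟶ A) e.hom := by
  have : Mono (0 : Z ⟶ A) := ⟨fun _ _ _ => hZ.eq_of_tgt _ _⟩
  exact isShortExactSeq_of_desc zero_comp fun k _ => ⟨e.inv ≫ k, by simp⟩

omit [HasExt.{w} C] in
theorem isShortExactSeq_iso_zero {A B : C} (e : A ≅ B) {Z : C} (hZ : IsZero Z) :
    IsShortExactSeq e.hom (0 : B ⟶ Z) := by
  have : Epi (0 : B ⟶ Z) := ⟨fun _ _ _ => hZ.eq_of_src _ _⟩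
  exact isShortExactSeq_of_desc comp_zero fun k hk =>
    ⟨0, by rw [comp_zero, ← cancel_epi e.hom, hk, comp_zero]⟩

omit [HasExt.{w} C] in
theorem IsRelCogenerator.exists_of_iso {XX ωω : Set C} (hcog : IsRelCogenerator XX ωω)
    {X M : C} (hX : X ∈ XX) (e : X ≅ M) : ∃ (W X' : C) (i : M ⟶ W) (p : W ⟶ X'),
      W ∈ ωω ∧ X' ∈ XX ∧ IsShortExactSeq i p := by
  obtain ⟨W, X', i, p, hW, hX', h⟩ := hcog.2 X hX
  have : Mono i := h.choose_spec.mono_f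
  have : Epi p := h.choose_spec.epi_g
  refine ⟨W, X', e.inv ≫ i, p, hW, hX', isShortExactSeq_of_desc
    (by rw [Category.assoc, h.choose, comp_zero]) fun k hk => h.exists_desc k ?_⟩
  rw [← cancel_epi e.inv, comp_zero, ← Category.assoc, hk]

omit [HasExt.{w} C] in
theorem HasResolutionLength.mono_class {XX YY : Set C} (hXY : XX ⊆ YY) {n : ℕ} {M : C}
    (h : HasResolutionLength XX n M) : HasResolutionLength YY n M := by
  induction h with
  | zero hX e => exact .zero (hXY hX) e
  | succ K X hX i p hse _ ih => exact .succ K X (hXY hX) i p hse ih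

omit [HasExt.{w} C] in
theorem resDim_le {XX : Set C} {n : ℕ} {M : C} (h : HasResolutionLength XX n M) :
    resDim XX M ≤ n :=
  sInf_le ⟨n, rfl, h⟩

omit [HasExt.{w} C] in
theorem hasResolutionLength_of_resDim_eq {XX : Set C} {n : ℕ} {M : C}
    (h : resDim XX M = n) : HasResolutionLength XX n M := by
  have hne : {m : ℕ∞ | ∃ n : ℕ, m = (n : ℕ∞) ∧ HasResolutionLength XX n M}.Nonempty := by
    by_contra hempty
    rw [Set.not_nonempty_iff_eq_empty] at hempty
    rw [resDim, hempty, sInf_empty] at h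
    exact ENat.top_ne_natCast n h
  obtain ⟨m, hm, hM⟩ := csInf_mem hne
  obtain rfl : n = m := by exact_mod_cast h.symm.trans hm
  exact hM

omit [HasExt.{w} C] in
theorem resDim_eq_of_shortExact {XX ωω : Set C} (hω : ωω ⊆ XX) {K X M : C} {i : K ⟶ X}
    {p : X ⟶ M} (hX : X ∈ XX) (hse : IsShortExactSeq i p) {m : ℕ}
    (hM : resDim XX M = ((m + 1 : ℕ) : ℕ∞)) (hK : HasResolutionLength ωω m K) :
    resDim ωω K = m := by
  refine le_antisymm (resDim_le hK) (le_sInf ?_)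
  rintro _ ⟨l, rfl, hl⟩
  have := hM ▸ resDim_le (.succ K X hX i p hse (hl.mono_class hω))
  norm_cast at this ⊢
  omega

omit [HasExt.{w} C] in
/-- The two Auslander–Buchweitz approximation sequences, for an object with an `XX`-resolution of
length `n`, obtained simultaneously. -/
theorem HasResolutionLength.exists_approximations {XX ωω : Set C}
    (hext : ClosedUnderExtensions XX) (hcog : IsRelCogenerator XX ωω)
    {n : ℕ} {M : C} (hM : HasResolutionLength XX n M) :
    (∃ (K X : C) (i : K ⟶ X) (p : X ⟶ M), X ∈ XX ∧ IsShortExactSeq i p ∧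
      ((n = 0 ∧ IsZero K) ∨ ∃ m : ℕ, n = m + 1 ∧ HasResolutionLength ωω m K)) ∧
    (∃ (H X' : C) (j : M ⟶ H) (q : H ⟶ X'), X' ∈ XX ∧ IsShortExactSeq j q ∧
      HasResolutionLength ωω n H) := by
  induction hM with
  | @zero M X hX e =>
    refine ⟨⟨0, X, 0, e.hom, hX, isShortExactSeq_zero_iso e (isZero_zero C),
      .inl ⟨rfl, isZero_zero C⟩⟩, ?_⟩
    obtain ⟨W, X', i, p, hW, hX', h⟩ := hcog.exists_of_iso hX e
    exact ⟨W, X', i, p, hX', h, .zero hW (Iso.refl W)⟩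
  | @succ n M K X hX i p hse _ ih =>
    obtain ⟨_, H, X', j, q, hX', hjq, hH⟩ := ih
    have sq := IsPushout.of_hasPushout i j
    obtain ⟨e, hHE, _⟩ := hse.exists_of_isPushout sq
    obtain ⟨r, hXE, _⟩ := hjq.exists_of_isPushout sq.flip
    have hE : pushout i j ∈ XX := hext _ _ hXE hX hX'
    refine ⟨⟨H, pushout i j, _, e, hE, hHE, .inr ⟨n, rfl, hH⟩⟩, ?_⟩
    obtain ⟨W, X'', u, s, hW, hX'', hus⟩ := hcog.2 _ hE
    have : Mono u := hus.choose_spec.mono_f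
    have sq' := IsPushout.of_hasPushout u e
    obtain ⟨t, ht, _⟩ := hus.exists_of_isPushout sq'
    exact ⟨pushout u e, X'', _, t, hX'', ht, .succ H W hW _ _ (hHE.comp_of_isPushout sq') hH⟩

theorem subsingleton_ext_of_isZero {X Z : C} (hZ : IsZero Z) (i : ℕ) :
    Subsingleton (Abelian.Ext.{w} X Z i) := by
  refine subsingleton_of_forall_eq 0 fun x => ?_
  rw [← x.comp_mk₀_id, hZ.eq_of_src (𝟙 Z) 0, Abelian.Ext.mk₀_zero, Abelian.Ext.comp_zero]

theorem subsingleton_ext_of_iso {X Y Z : C} (e : Y ≅ Z) (i : ℕ)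
    [Subsingleton (Abelian.Ext.{w} X Y i)] : Subsingleton (Abelian.Ext.{w} X Z i) := by
  refine subsingleton_of_forall_eq 0 fun x => ?_
  have hx : x.comp (Abelian.Ext.mk₀ e.inv) (add_zero i) = 0 := Subsingleton.elim _ _
  rw [← x.comp_mk₀_id, ← e.inv_hom_id, ← Abelian.Ext.mk₀_comp_mk₀,
    ← Abelian.Ext.comp_assoc_of_third_deg_zero, hx, Abelian.Ext.zero_comp]

theorem subsingleton_ext_of_shortExact {X A B D : C} {f : A ⟶ B} {g : B ⟶ D}
    (h : IsShortExactSeq f g) (i : ℕ) [Subsingleton (Abelian.Ext.{w} X B i)]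
    [Subsingleton (Abelian.Ext.{w} X A (i + 1))] : Subsingleton (Abelian.Ext.{w} X D i) := by
  obtain ⟨_, h⟩ := h
  refine subsingleton_of_forall_eq 0 fun x => ?_
  obtain ⟨y, rfl⟩ := Abelian.Ext.covariant_sequence_exact₃ X h x rfl
    (Subsingleton.elim (α := Abelian.Ext.{w} X A (i + 1)) _ _)
  rw [Subsingleton.elim (α := Abelian.Ext.{w} X B i) y 0, Abelian.Ext.zero_comp]

theorem HasResolutionLength.mem_rightPerp {XX ωω : Set C} (hinj : IsRelInjective.{w} XX ωω)
    {n : ℕ} {M : C} (hM : HasResolutionLength ωω n M) : M ∈ rightPerp.{w} XX := by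
  induction hM with
  | zero hW e =>
    intro X hX i hi
    have := hinj _ hW X hX i hi
    exact subsingleton_ext_of_iso e i
  | succ K W hW _ _ hse _ ih =>
    intro X hX i hi
    have := hinj _ hW X hX i hi
    have := ih X hX (i + 1) i.succ_pos
    exact subsingleton_ext_of_shortExact hse i

theorem IsShortExactSeq.exists_lift {X A B D : C} {f : A ⟶ B} {g : B ⟶ D}
    (h : IsShortExactSeq f g) [Subsingleton (Abelian.Ext.{w} X A 1)] (t : X ⟶ D) :
    ∃ s : X ⟶ B, s ≫ g = t := by
  obtain ⟨_, h⟩ := h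
  obtain ⟨y, hy⟩ := Abelian.Ext.covariant_sequence_exact₃ X h (Abelian.Ext.mk₀ t) (zero_add 1)
    (Subsingleton.elim (α := Abelian.Ext.{w} X A 1) _ _)
  obtain ⟨s, rfl⟩ := (Abelian.Ext.mk₀_bijective X B).2 y
  rw [Abelian.Ext.mk₀_comp_mk₀] at hy
  exact ⟨s, (Abelian.Ext.mk₀_bijective X D).1 hy⟩

theorem IsShortExactSeq.exists_extension {A B D Y : C} {f : A ⟶ B} {g : B ⟶ D}
    (h : IsShortExactSeq f g) [Subsingleton (Abelian.Ext.{w} D Y 1)] (t : A ⟶ Y) :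
    ∃ s : B ⟶ Y, f ≫ s = t := by
  obtain ⟨_, h⟩ := h
  obtain ⟨y, hy⟩ := Abelian.Ext.contravariant_sequence_exact₁ h Y (Abelian.Ext.mk₀ t)
    (add_zero 1) (Subsingleton.elim (α := Abelian.Ext.{w} D Y 1) _ _)
  obtain ⟨s, rfl⟩ := (Abelian.Ext.mk₀_bijective B Y).2 y
  rw [Abelian.Ext.mk₀_comp_mk₀] at hy
  exact ⟨s, (Abelian.Ext.mk₀_bijective A Y).1 hy⟩

/-- Theorem AB4. If `X` is closed under extensions, `0 ∈ X`, and
`ω` is an `X`-injective relative cogenerator in `X`, then any `C'` with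
`resdim_X(C') = n < ∞` fits in short exact sequences `0 → K → X --φ--> C' → 0` and
`0 → C' --φ'--> H → X' → 0` with `X, X' ∈ X`, `resdim_ω(K) = n − 1` (where `−1`
means `K = 0`), `resdim_ω(H) ≤ n`, `φ` an `X`-precover with `K ∈ X^⊥`, and `φ'` an
`ω^∧`-preenvelope with `X' ∈ ^⊥(ω^∧)`. -/
theorem stmt3 (XX ωω : Set C) (hext : ClosedUnderExtensions XX)
    (h0 : (0 : C) ∈ XX) (hcog : IsRelCogenerator XX ωω)
    (hinj : IsRelInjective XX ωω)
    (C' : C) (n : ℕ) (hres : resDim XX C' = (n : ℕ∞)) :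
    (∃ (K X : C) (i : K ⟶ X) (φ : X ⟶ C'), X ∈ XX ∧ IsShortExactSeq i φ ∧
      ((n = 0 ∧ IsZero K) ∨ ∃ m : ℕ, n = m + 1 ∧ resDim ωω K = (m : ℕ∞)) ∧
      IsPrecover XX φ ∧ K ∈ rightPerp XX) ∧
    (∃ (H X' : C) (φ' : C' ⟶ H) (p : H ⟶ X'), X' ∈ XX ∧ IsShortExactSeq φ' p ∧
      resDim ωω H ≤ (n : ℕ∞) ∧
      IsPreenvelope (resHat ωω) φ' ∧ X' ∈ leftPerp (resHat ωω)) := by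
  obtain ⟨⟨K, X, i, φ, hX, hse, hK⟩, H, X', φ', p, hX', hse', hH⟩ :=
    (hasResolutionLength_of_resDim_eq hres).exists_approximations hext hcog
  have hKperp : K ∈ rightPerp.{w} XX := by
    rcases hK with ⟨_, hK⟩ | ⟨m, _, hK⟩
    · exact fun _ _ j _ => subsingleton_ext_of_isZero hK j
    · exact hK.mem_rightPerp hinj
  have hX'perp : X' ∈ leftPerp.{w} (resHat ωω) := fun Y ⟨_, hY⟩ j hj =>
    hY.mem_rightPerp hinj X' hX' j hj
  refine ⟨⟨K, X, i, φ, hX, hse, hK.imp_right ?_, ⟨hX, fun T hT f => ?_⟩, hKperp⟩,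
    H, X', φ', p, hX', hse', resDim_le hH, ⟨⟨n, hH⟩, fun Y hY f => ?_⟩, hX'perp⟩
  · rintro ⟨m, rfl, hKm⟩
    exact ⟨m, rfl, resDim_eq_of_shortExact hcog.1 hX hse hres hKm⟩
  · have := hKperp T hT 1 one_pos
    exact hse.exists_lift f
  · have := hX'perp Y hY 1 one_pos
    exact hse'.exists_extension f

end ABFormal
end

section
/- Let C be an abelian category, X a class of objects closed under extensions and direct summands in C, and ω an X-injective relative cogenerator in X which is closed under direct summands in C. Then pd_{ω^∧}(C') = pd_ω(C') = resdim_X(C') for every C' ∈ X^∧. -/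
/-!
Common definitions for Auslander–Buchweitz approximation theory in abelian
categories, following Becerril–Mendoza–Pérez–Santiago.
-/

open CategoryTheory CategoryTheory.Limits ZeroObject

universe w v u

namespace ABFormal

variable {C : Type u} [Category.{v} C] [Abelian C] [CategoryTheory.HasExt.{w} C]

/-- Two predicates on `ℕ` which dominate each other have the same infimum in `ℕ∞`. -/
theorem sInf_natCast_le_of_forall_exists_le {P Q : ℕ → Prop}
    (h : ∀ n, Q n → ∃ m ≤ n, P m) :
    sInf {a : ℕ∞ | ∃ n : ℕ, a = n ∧ P n} ≤ sInf {a : ℕ∞ | ∃ n : ℕ, a = n ∧ Q n} := by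
  refine le_sInf ?_
  rintro _ ⟨n, rfl, hn⟩
  obtain ⟨m, hmn, hm⟩ := h n hn
  exact sInf_le_of_le ⟨m, rfl, hm⟩ (Nat.cast_le.mpr hmn)

theorem subsingleton_ext_of_retract {A B : C} (s : A ⟶ B) (r : B ⟶ A) (h : s ≫ r = 𝟙 A)
    (Y : C) (n : ℕ) [Subsingleton (Abelian.Ext.{w} B Y n)] :
    Subsingleton (Abelian.Ext.{w} A Y n) := by
  refine subsingleton_of_forall_eq 0 fun x => ?_
  have hx : (Abelian.Ext.mk₀ r).comp x (zero_add n) = 0 := Subsingleton.elim _ _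
  rw [← Abelian.Ext.mk₀_id_comp x, ← h, ← Abelian.Ext.mk₀_comp_mk₀_assoc, hx,
    Abelian.Ext.comp_zero]

theorem subsingleton_ext_of_retract_right {A B : C} (s : A ⟶ B) (r : B ⟶ A) (h : s ≫ r = 𝟙 A)
    (X : C) (n : ℕ) [Subsingleton (Abelian.Ext.{w} X B n)] :
    Subsingleton (Abelian.Ext.{w} X A n) := by
  refine subsingleton_of_forall_eq 0 fun x => ?_
  have hx : x.comp (Abelian.Ext.mk₀ s) (add_zero n) = 0 := Subsingleton.elim _ _
  rw [← Abelian.Ext.comp_mk₀_id x, ← h, ← Abelian.Ext.mk₀_comp_mk₀,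
    ← Abelian.Ext.comp_assoc_of_third_deg_zero, hx, Abelian.Ext.zero_comp]

/-- In a short exact sequence `S`, the vanishing of `Ext^n(S.X₁, Y)` and `Ext^(n+1)(S.X₂, Y)`
implies that of `Ext^(n+1)(S.X₃, Y)`. -/
theorem subsingleton_ext_X₃ {S : ShortComplex C} (hS : S.ShortExact) (Y : C) (n : ℕ)
    [Subsingleton (Abelian.Ext.{w} S.X₁ Y n)] [Subsingleton (Abelian.Ext.{w} S.X₂ Y (n + 1))] :
    Subsingleton (Abelian.Ext.{w} S.X₃ Y (n + 1)) := by
  refine subsingleton_of_forall_eq 0 fun x => ?_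
  obtain ⟨y, rfl⟩ := Abelian.Ext.contravariant_sequence_exact₃ hS Y x
    (Subsingleton.elim _ _) (add_comm 1 n)
  rw [Subsingleton.elim y 0, Abelian.Ext.comp_zero]

/-- In a short exact sequence `S`, the vanishing of `Ext^n(S.X₂, Y)` and `Ext^(n+1)(S.X₃, Y)`
implies that of `Ext^n(S.X₁, Y)`. -/
theorem subsingleton_ext_X₁ {S : ShortComplex C} (hS : S.ShortExact) (Y : C) (n : ℕ)
    [Subsingleton (Abelian.Ext.{w} S.X₂ Y n)] [Subsingleton (Abelian.Ext.{w} S.X₃ Y (n + 1))] :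
    Subsingleton (Abelian.Ext.{w} S.X₁ Y n) := by
  refine subsingleton_of_forall_eq 0 fun x => ?_
  obtain ⟨y, rfl⟩ := Abelian.Ext.contravariant_sequence_exact₁ hS Y x (add_comm 1 n)
    (Subsingleton.elim _ _)
  rw [Subsingleton.elim y 0, Abelian.Ext.comp_zero]

/-- In a short exact sequence `S`, the vanishing of `Ext^n(X, S.X₂)` and `Ext^(n+1)(X, S.X₁)`
implies that of `Ext^n(X, S.X₃)`. -/
theorem subsingleton_ext_right_X₃ {S : ShortComplex C} (hS : S.ShortExact) (X : C) (n : ℕ)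
    [Subsingleton (Abelian.Ext.{w} X S.X₂ n)] [Subsingleton (Abelian.Ext.{w} X S.X₁ (n + 1))] :
    Subsingleton (Abelian.Ext.{w} X S.X₃ n) := by
  refine subsingleton_of_forall_eq 0 fun x => ?_
  obtain ⟨y, rfl⟩ := Abelian.Ext.covariant_sequence_exact₃ X hS x rfl (Subsingleton.elim _ _)
  rw [Subsingleton.elim y 0, Abelian.Ext.zero_comp]

/-- A morphism from the first term of a short exact sequence extends to the middle term when
`Ext^1` from the last term into the target vanishes. -/
theorem exists_extension_of_subsingleton_ext {S : ShortComplex C} (hS : S.ShortExact) {Y : C}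
    [Subsingleton (Abelian.Ext.{w} S.X₃ Y 1)] (u : S.X₁ ⟶ Y) :
    ∃ f : S.X₂ ⟶ Y, S.f ≫ f = u := by
  obtain ⟨y, hy⟩ := Abelian.Ext.contravariant_sequence_exact₁ hS Y (Abelian.Ext.mk₀ u)
    (add_zero 1) (Subsingleton.elim _ _)
  obtain ⟨f, rfl⟩ := (Abelian.Ext.mk₀_bijective _ _).2 y
  exact ⟨f, (Abelian.Ext.mk₀_bijective _ _).1 (by rw [← hy, Abelian.Ext.mk₀_comp_mk₀])⟩

/-- If `0 → A → B → M → 0` and `0 → A → W → Q → 0` are short exact and the monomorphism `A ⟶ W`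
extends to `f : B ⟶ W`, then there is a short exact sequence `0 → B → W ⊞ M → Q → 0`. -/
theorem exists_isShortExactSeq_biprod {A B M W Q : C} {i : A ⟶ B} {p : B ⟶ M} {u : A ⟶ W}
    {q : W ⟶ Q} (hip : IsShortExactSeq i p) (huq : IsShortExactSeq u q) {f : B ⟶ W}
    (hf : i ≫ f = u) :
    ∃ g : W ⊞ M ⟶ Q, IsShortExactSeq (biprod.lift f p) g := by
  obtain ⟨hip₀, hip⟩ := hip
  obtain ⟨huq₀, huq⟩ := huq
  have := hip.mono_f
  have := hip.epi_g
  have := huq.mono_f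
  have := huq.epi_g
  dsimp only at *
  have hi : i ≫ f ≫ q = 0 := by rw [reassoc_of% hf, huq₀]
  let d : M ⟶ Q := hip.exact.desc (f ≫ q) hi
  have hd : p ≫ d = f ≫ q := hip.exact.g_desc _ hi
  have hw : biprod.lift f p ≫ biprod.desc q (-d) = 0 := by simp [biprod.lift_desc, hd]
  refine ⟨biprod.desc q (-d), hw, ?_⟩
  have hmono : Mono (biprod.lift f p) := by
    refine Preadditive.mono_of_cancel_zero _ fun {Z} x hx => ?_
    have h₁ : x ≫ f = 0 := by simpa using hx =≫ biprod.fst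
    have h₂ : x ≫ p = 0 := by simpa using hx =≫ biprod.snd
    have hl : hip.exact.lift x h₂ ≫ i = x := hip.exact.lift_f x h₂
    have : hip.exact.lift x h₂ = 0 := by
      rw [← cancel_mono u, ← hf, reassoc_of% hl, h₁, zero_comp]
    rw [← hl, this, zero_comp]
  have hepi : Epi (biprod.desc q (-d)) := by
    have : Epi (biprod.inl ≫ biprod.desc q (-d)) := by
      rw [biprod.inl_desc]
      infer_instance
    exact epi_of_epi biprod.inl _
  refine { exact := ?_, mono_f := hmono, epi_g := hepi }
  rw [ShortComplex.exact_iff_exact_up_to_refinements]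
  intro T x hx
  dsimp only at x hx ⊢
  obtain ⟨T', π, hπ, b, hb⟩ := surjective_up_to_refinements_of_epi p (x ≫ biprod.snd)
  have hx' : (x ≫ biprod.fst) ≫ q = (x ≫ biprod.snd) ≫ d := by
    simpa [biprod.desc_eq, ← sub_eq_add_neg, sub_eq_zero] using hx
  have hz : (π ≫ x ≫ biprod.fst - b ≫ f) ≫ q = 0 := by
    rw [Preadditive.sub_comp, Category.assoc, hx', ← Category.assoc π, hb, Category.assoc,
      Category.assoc, hd, sub_self]
  let a : T' ⟶ A := huq.exact.lift _ hz
  have ha : a ≫ u = π ≫ x ≫ biprod.fst - b ≫ f := huq.exact.lift_f _ hz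
  refine ⟨T', π, hπ, b + a ≫ i, ?_⟩
  ext
  · simp [hf, ha]
  · simp [hip₀, hb]

theorem HasResolutionLength.relProjDimLE_of_isRelInjective {XX ωω : Set C} (hinj : IsRelInjective.{w} XX ωω)
    {n : ℕ} {M : C} (h : HasResolutionLength XX n M) : relProjDimLE.{w} ωω M n := by
  intro W hW
  induction h with
  | zero hX e =>
    intro j hj
    have := hinj W hW _ hX j hj
    exact subsingleton_ext_of_retract e.inv e.hom e.inv_hom_id W j
  | succ K X hX i p hse _ ih =>
    rintro (_ | j) hj
    · omega
    obtain ⟨_, hS⟩ := hse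
    have := ih j (by omega)
    have := hinj W hW X hX (j + 1) j.succ_pos
    exact subsingleton_ext_X₃ hS W j

theorem relProjDimLE.to_resHat {ωω : Set C} {M : C} {n : ℕ} (h : relProjDimLE.{w} ωω M n) :
    relProjDimLE.{w} (resHat ωω) M n := by
  rintro N ⟨k, hN⟩
  induction hN with
  | zero hX e =>
    intro j hj
    have := h _ hX j hj
    exact subsingleton_ext_of_retract_right e.inv e.hom e.inv_hom_id M j
  | succ K X hX i p hse _ ih =>
    intro j hj
    obtain ⟨_, hS⟩ := hse
    have := ih (j + 1) (by omega)
    have := h X hX j hj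
    exact subsingleton_ext_right_X₃ hS M j

/-- A resolution of length `m + 1` can be shortened as soon as the relative projective
dimension is at most `m`. -/
theorem HasResolutionLength.pred {XX ωω : Set C} (hext : ClosedUnderExtensions XX)
    (hsum : ClosedUnderSummands XX) (hinj : IsRelInjective.{w} XX ωω)
    (hcog : IsRelCogenerator XX ωω) {m : ℕ} {M : C} (h : HasResolutionLength XX (m + 1) M)
    (hpd : relProjDimLE.{w} ωω M m) : HasResolutionLength XX m M := by
  induction m generalizing M with
  | zero =>
    obtain _ | ⟨K, X, hX, i, p, hse, hK⟩ := h
    obtain ⟨hX', e⟩ := hK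
    obtain ⟨W, Q, u, q, hW, hQ, huq⟩ := hcog.2 K (hsum hX' e.inv e.hom e.inv_hom_id)
    have := hpd W hW 1 one_pos
    obtain ⟨_, hS⟩ := id hse
    obtain ⟨f, hf⟩ := exists_extension_of_subsingleton_ext hS u
    obtain ⟨g, hg⟩ := exists_isShortExactSeq_biprod hse huq hf
    exact .zero (hsum (hext _ _ hg hX hQ) biprod.inr biprod.snd biprod.inr_snd) (Iso.refl M)
  | succ m ih =>
    obtain _ | ⟨K, X, hX, i, p, hse, hK⟩ := h
    refine .succ K X hX i p hse (ih hK fun W hW j hj => ?_)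
    obtain ⟨_, hS⟩ := hse
    have := hinj W hW X hX j (by omega)
    have := hpd W hW (j + 1) (by omega)
    exact subsingleton_ext_X₁ hS W j

theorem HasResolutionLength.exists_le {XX ωω : Set C} (hext : ClosedUnderExtensions XX)
    (hsum : ClosedUnderSummands XX) (hinj : IsRelInjective.{w} XX ωω)
    (hcog : IsRelCogenerator XX ωω) {k n : ℕ} {M : C} (h : HasResolutionLength XX k M)
    (hpd : relProjDimLE.{w} ωω M n) : ∃ m ≤ n, HasResolutionLength XX m M := by
  induction k with
  | zero => exact ⟨0, n.zero_le, h⟩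
  | succ k ih =>
    by_cases hk : k + 1 ≤ n
    · exact ⟨k + 1, hk, h⟩
    · exact ih (h.pred hext hsum hinj hcog fun W hW j hj => hpd W hW j (by omega))

/-- Theorem AB8. If `X` is closed under extensions and direct
summands, and `ω` is an `X`-injective relative cogenerator in `X` closed under
direct summands, then `pd_{ω^∧}(C') = pd_ω(C') = resdim_X(C')` for all `C' ∈ X^∧`. -/
theorem stmt5 (XX ωω : Set C) (hext : ClosedUnderExtensions XX)
    (hsum : ClosedUnderSummands XX) (hinj : IsRelInjective XX ωω)
    (hcog : IsRelCogenerator XX ωω) (hωsum : ClosedUnderSummands ωω) :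
    ∀ C' ∈ resHat XX,
      relProjDim (resHat ωω) C' = relProjDim ωω C' ∧
      relProjDim ωω C' = resDim XX C' := by
  rintro M ⟨k, hM⟩
  refine ⟨le_antisymm ?_ ?_, le_antisymm ?_ ?_⟩
  · exact sInf_natCast_le_of_forall_exists_le fun n hn => ⟨n, le_rfl, hn.to_resHat⟩
  · exact sInf_natCast_le_of_forall_exists_le fun n hn =>
      ⟨n, le_rfl, fun W hW => hn W ⟨0, .zero hW (Iso.refl W)⟩⟩
  · exact sInf_natCast_le_of_forall_exists_le fun n hn =>
      ⟨n, le_rfl, hn.relProjDimLE_of_isRelInjective hinj⟩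
  · exact sInf_natCast_le_of_forall_exists_le fun n hn => hM.exists_le hext hsum hinj hcog hn

end ABFormal
end

section
/- Let C be an abelian category, X a pre-resolving class of objects of C, and ω an X-injective relative cogenerator in X. Then: (a) X^∧ is the smallest class of objects of C containing X which is both pre-resolving and pre-coresolving; (b) if in addition X and ω are closed under direct summands in C, then X^∧ is closed under direct summands in C. In particular, if (X,ω) is a left Frobenius pair in C, then X^∧ is the smallest thick class of C containing X. -/
/-!
Common definitions for Auslander–Buchweitz approximation theory in abelian
categories, following Becerril–Mendoza–Pérez–Santiago.
-/

open CategoryTheory CategoryTheory.Limits ZeroObject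

universe w v u

namespace ABFormal

variable {C : Type u} [Category.{v} C] [Abelian C] [CategoryTheory.HasExt.{w} C]

section

omit [HasExt.{w} C]

namespace IsShortExactSeq

variable {A B D : C} {f : A ⟶ B} {g : B ⟶ D}

lemma of_kernel (w : f ≫ g = 0) [Mono f] [Epi g]
    (h : ∀ ⦃T : C⦄ (t : T ⟶ B), t ≫ g = 0 → ∃ l : T ⟶ A, l ≫ f = t) :
    IsShortExactSeq f g := by
  choose l hl using h
  exact ⟨w, { exact := ShortComplex.exact_of_f_is_kernel _
                (KernelFork.IsLimit.ofι' f w fun k hk => ⟨l k hk, hl k hk⟩)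
              mono_f := ‹_›
              epi_g := ‹_› }⟩

lemma of_cokernel (w : f ≫ g = 0) [Mono f] [Epi g]
    (h : ∀ ⦃T : C⦄ (t : B ⟶ T), f ≫ t = 0 → ∃ l : D ⟶ T, g ≫ l = t) :
    IsShortExactSeq f g := by
  choose l hl using h
  exact ⟨w, { exact := ShortComplex.exact_of_g_is_cokernel _
                (CokernelCofork.IsColimit.ofπ' g w fun k hk => ⟨l k hk, hl k hk⟩)
              mono_f := ‹_›
              epi_g := ‹_› }⟩

lemma mono (h : IsShortExactSeq f g) : Mono f := h.choose_spec.mono_f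

lemma epi (h : IsShortExactSeq f g) : Epi g := h.choose_spec.epi_g

lemma comp_eq_zero (h : IsShortExactSeq f g) : f ≫ g = 0 := h.choose

lemma exists_lift_s6 (h : IsShortExactSeq f g) {T : C} (t : T ⟶ B) (ht : t ≫ g = 0) :
    ∃ l : T ⟶ A, l ≫ f = t := by
  obtain ⟨_, hS⟩ := h
  have := hS.mono_f
  exact ⟨hS.exact.lift t ht, hS.exact.lift_f t ht⟩

lemma exists_desc_s6 (h : IsShortExactSeq f g) {T : C} (t : B ⟶ T) (ht : f ≫ t = 0) :
    ∃ l : D ⟶ T, g ≫ l = t := by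
  obtain ⟨_, hS⟩ := h
  have := hS.epi_g
  exact ⟨hS.exact.desc t ht, hS.exact.g_desc t ht⟩

lemma of_kernel_ι (g : B ⟶ D) [Epi g] : IsShortExactSeq (kernel.ι g) g :=
  of_kernel (kernel.condition g) fun _ t ht => ⟨kernel.lift g t ht, kernel.lift_ι g t ht⟩

lemma zero_left (A : C) : IsShortExactSeq (0 : (0 : C) ⟶ A) (𝟙 A) := by
  have : Mono (0 : (0 : C) ⟶ A) := ⟨fun _ _ _ => (isZero_zero C).eq_of_tgt _ _⟩
  exact of_kernel zero_comp fun _ t ht => ⟨0, by simpa using ht.symm⟩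

lemma of_iso_zero_right (e : A ≅ B) : IsShortExactSeq e.hom (0 : B ⟶ (0 : C)) := by
  have : Epi (0 : B ⟶ (0 : C)) := ⟨fun _ _ _ => (isZero_zero C).eq_of_src _ _⟩
  exact of_kernel comp_zero fun _ t _ => ⟨t ≫ e.inv, by simp⟩

lemma biprod_inl_snd (A B : C) : IsShortExactSeq (biprod.inl : A ⟶ A ⊞ B) biprod.snd :=
  of_kernel biprod.inl_snd fun _ t ht => ⟨t ≫ biprod.fst, by ext <;> simp [ht]⟩

/-- The row of kernels of a pullback square whose right leg is an epimorphism. -/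
lemma of_isPullback {P X : C} {fst : P ⟶ X} {snd : P ⟶ B} {p : X ⟶ D}
    (hP : IsPullback fst snd p g) (h : IsShortExactSeq f g) :
    ∃ a : A ⟶ P, IsShortExactSeq a fst ∧ a ≫ snd = f := by
  have := h.epi
  have := h.mono
  have : Epi fst := Abelian.epi_fst_of_isLimit _ _ hP.isLimit
  have w : (0 : A ⟶ X) ≫ p = f ≫ g := by rw [zero_comp, h.comp_eq_zero]
  have hs : hP.lift 0 f w ≫ snd = f := hP.lift_snd _ _ _
  have : Mono (hP.lift 0 f w) := mono_of_mono_fac hs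
  refine ⟨hP.lift 0 f w, of_kernel (hP.lift_fst _ _ _) fun T t ht => ?_, hs⟩
  obtain ⟨l, hl⟩ := h.exists_lift_s6 (t ≫ snd) (by
    rw [Category.assoc, ← hP.w, reassoc_of% ht, zero_comp])
  exact ⟨l, hP.hom_ext (by simp [ht]) (by simp [hl])⟩

/-- The row of cokernels of a pushout square whose top leg is a monomorphism. -/
lemma of_isPushout {P X : C} {j : A ⟶ X} {inl : X ⟶ P} {inr : B ⟶ P}
    (hP : IsPushout j f inl inr) (h : IsShortExactSeq f g) :
    ∃ b : P ⟶ D, IsShortExactSeq inl b ∧ inr ≫ b = g := by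
  have := h.epi
  have := h.mono
  have : Mono inl := Abelian.mono_inl_of_isColimit _ _ hP.isColimit
  have w : j ≫ (0 : X ⟶ D) = f ≫ g := by rw [comp_zero, h.comp_eq_zero]
  have hs : inr ≫ hP.desc 0 g w = g := hP.inr_desc _ _ _
  have : Epi (hP.desc 0 g w) := epi_of_epi_fac hs
  refine ⟨hP.desc 0 g w, of_cokernel (hP.inl_desc _ _ _) fun T t ht => ?_, hs⟩
  obtain ⟨l, hl⟩ := h.exists_desc_s6 (inr ≫ t) (by
    rw [← Category.assoc, ← hP.w, Category.assoc, ht, comp_zero])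
  exact ⟨l, hP.hom_ext (by simp [ht]) (by simp [reassoc_of% hs, hl])⟩

/-- Pullback of two short exact sequences with the same right-hand term. -/
lemma exists_pullback {K X : C} {k : K ⟶ X} {p : X ⟶ D}
    (h : IsShortExactSeq f g) (h' : IsShortExactSeq k p) :
    ∃ (P : C) (a : A ⟶ P) (b : P ⟶ X) (c : K ⟶ P) (d : P ⟶ B),
      IsShortExactSeq a b ∧ IsShortExactSeq c d := by
  obtain ⟨a, ha, _⟩ := of_isPullback (IsPullback.of_hasPullback p g) h
  obtain ⟨c, hc, _⟩ := of_isPullback (IsPullback.of_hasPullback p g).flip h'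
  exact ⟨_, a, _, c, _, ha, hc⟩

/-- Pushout of two short exact sequences with the same left-hand term. -/
lemma exists_pushout {X Q : C} {j : A ⟶ X} {q : X ⟶ Q}
    (h : IsShortExactSeq f g) (h' : IsShortExactSeq j q) :
    ∃ (P : C) (a : X ⟶ P) (b : P ⟶ D) (c : B ⟶ P) (d : P ⟶ Q),
      IsShortExactSeq a b ∧ IsShortExactSeq c d := by
  obtain ⟨b, hb, _⟩ := of_isPushout (IsPushout.of_hasPushout j f) h
  obtain ⟨d, hd, _⟩ := of_isPushout (IsPushout.of_hasPushout j f).flip h'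
  exact ⟨_, _, b, _, d, hb, hd⟩

/-- The kernel of a composition of epimorphisms is an extension of the kernels. -/
lemma exists_kernel_comp {K X : C} {k : K ⟶ X} {p : X ⟶ B}
    (h : IsShortExactSeq f g) (h' : IsShortExactSeq k p) :
    ∃ (L : C) (a : L ⟶ X) (c : K ⟶ L) (d : L ⟶ A),
      IsShortExactSeq a (p ≫ g) ∧ IsShortExactSeq c d := by
  have hP := IsPullback.of_hasPullback f p
  obtain ⟨c, hc, _⟩ := of_isPullback hP h'
  have := h.mono
  have := h.epi
  have := h'.epi
  refine ⟨_, pullback.snd f p, c, _, of_kernel ?_ fun T t ht => ?_, hc⟩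
  · rw [← Category.assoc, ← hP.w, Category.assoc, h.comp_eq_zero, comp_zero]
  · obtain ⟨l, hl⟩ := h.exists_lift_s6 (t ≫ p) (by simpa using ht)
    exact ⟨hP.lift l t hl, hP.lift_snd _ _ _⟩

/-- The cokernel of a composition of monomorphisms is an extension of the cokernels. -/
lemma exists_cokernel_comp {X Q : C} {j : B ⟶ X} {q : X ⟶ Q}
    (h : IsShortExactSeq f g) (h' : IsShortExactSeq j q) :
    ∃ (P : C) (b : X ⟶ P) (c : D ⟶ P) (d : P ⟶ Q),
      IsShortExactSeq (f ≫ j) b ∧ IsShortExactSeq c d := by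
  have hP := IsPushout.of_hasPushout g j
  obtain ⟨d, hd, _⟩ := of_isPushout hP h'
  have := h.mono
  have := h.epi
  have := h'.mono
  refine ⟨_, pushout.inr g j, _, d, of_cokernel ?_ fun T t ht => ?_, hd⟩
  · rw [Category.assoc, ← hP.w, ← Category.assoc, h.comp_eq_zero, zero_comp]
  · obtain ⟨l, hl⟩ := h.exists_desc_s6 (j ≫ t) (by simpa using ht)
    exact ⟨hP.desc l t hl, hP.inr_desc _ _ _⟩

lemma exists_section [HasExt.{w} C] (h : IsShortExactSeq f g) (hE : Subsingleton (Abelian.Ext.{w} D A 1)) :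
    ∃ s : D ⟶ B, s ≫ g = 𝟙 D := by
  obtain ⟨w, hS⟩ := h
  obtain ⟨x, hx⟩ := Abelian.Ext.covariant_sequence_exact₃ D hS (Abelian.Ext.mk₀ (𝟙 D))
    (zero_add 1) (hE.elim _ _)
  obtain ⟨s, rfl⟩ := (Abelian.Ext.mk₀_bijective D B).2 x
  exact ⟨s, (Abelian.Ext.mk₀_bijective D D).1 (by simpa using hx)⟩

/-- A cover of the left-hand term of a split extension, extended to the middle term. -/
lemma biprod_desc {K X : C} {k : K ⟶ X} {p : X ⟶ A} {s : D ⟶ B}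
    (h : IsShortExactSeq f g) (hs : s ≫ g = 𝟙 D) (h' : IsShortExactSeq k p) :
    IsShortExactSeq (k ≫ biprod.inl) (biprod.desc (p ≫ f) s) := by
  have := h.mono
  have := h.epi
  have := h'.mono
  have := h'.epi
  have : Epi (biprod.desc (p ≫ f) s) := by
    refine Preadditive.epi_of_cancel_zero _ fun {T} t ht => ?_
    have h₁ : f ≫ t = 0 := by
      rw [← cancel_epi p]
      simpa using biprod.inl ≫= ht
    have h₂ : s ≫ t = 0 := by simpa using biprod.inr ≫= ht
    obtain ⟨l, rfl⟩ := h.exists_desc_s6 t h₁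
    rw [reassoc_of% hs] at h₂
    rw [h₂, comp_zero]
  refine of_kernel (by simp [reassoc_of% h'.comp_eq_zero]) fun T t ht => ?_
  rw [biprod.desc_eq, Preadditive.comp_add] at ht
  have h₂ : t ≫ biprod.snd = 0 := by
    simpa [h.comp_eq_zero, hs] using ht =≫ g
  obtain ⟨l, hl⟩ := h'.exists_lift_s6 (t ≫ biprod.fst) (by
    rw [← cancel_mono f]
    simpa [reassoc_of% h₂] using ht)
  exact ⟨l, by ext <;> simp [hl, h₂]⟩

/-- A cover of an object yields a cover of each retract, whose kernel is a retract of the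
kernel of another cover of the object. -/
lemma exists_cover_of_retract {K X M N : C} {k : K ⟶ X} {p : X ⟶ M} (h : IsShortExactSeq k p)
    {s : N ⟶ M} {r : M ⟶ N} (hsr : s ≫ r = 𝟙 N) :
    ∃ (L L' : C) (a : L ⟶ X) (b : X ⟶ N) (a' : L' ⟶ X ⊞ X) (b' : X ⊞ X ⟶ M)
      (s' : L ⟶ L') (r' : L' ⟶ L),
      IsShortExactSeq a b ∧ IsShortExactSeq a' b' ∧ s' ≫ r' = 𝟙 L := by
  have := h.epi
  have : Epi r := epi_of_epi_fac hsr
  let q : X ⊞ X ⟶ M := biprod.desc (p ≫ r ≫ s) (p ≫ (𝟙 M - r ≫ s))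
  have : Epi q := by
    refine Preadditive.epi_of_cancel_zero _ fun {T} t ht => ?_
    have h₁ : r ≫ s ≫ t = 0 := by
      rw [← cancel_epi p]
      simpa [q] using biprod.inl ≫= ht
    rw [← cancel_epi p]
    simpa [q, h₁, Preadditive.sub_comp] using biprod.inr ≫= ht
  refine ⟨_, _, _, p ≫ r, _, q,
    kernel.lift q (kernel.ι (p ≫ r) ≫ biprod.inl) ?_,
    kernel.lift (p ≫ r) (kernel.ι q ≫ biprod.fst) ?_,
    of_kernel_ι _, of_kernel_ι _, ?_⟩
  · have := kernel.condition (p ≫ r)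
    rw [Category.assoc, biprod.inl_desc, reassoc_of% this, zero_comp]
  · have := kernel.condition q =≫ r
    simpa [q, biprod.desc_eq, hsr] using this
  · rw [← cancel_mono (kernel.ι (p ≫ r))]
    simp

end IsShortExactSeq

variable {XX ωω : Set C}

lemma IsPreresolving.zero_mem (h : IsPreresolving XX) {X : C} (hX : X ∈ XX) : (0 : C) ∈ XX :=
  h.2 _ _ (IsShortExactSeq.zero_left X) hX hX

lemma IsPreresolving.mem_of_iso (h : IsPreresolving XX) {X M : C} (hX : X ∈ XX) (e : X ≅ M) :
    M ∈ XX :=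
  h.1 _ _ (IsShortExactSeq.of_iso_zero_right e) hX (h.zero_mem hX)

lemma IsPreresolving.biprod_mem (h : IsPreresolving XX) {X Y : C} (hX : X ∈ XX) (hY : Y ∈ XX) :
    (X ⊞ Y) ∈ XX :=
  h.1 _ _ (IsShortExactSeq.biprod_inl_snd X Y) hX hY

namespace HasResolutionLength

lemma of_mem {M : C} (hM : M ∈ XX) : HasResolutionLength XX 0 M :=
  .zero hM (Iso.refl M)

lemma mem (h : IsPreresolving XX) {M : C} (hM : HasResolutionLength XX 0 M) : M ∈ XX := by
  cases hM with
  | zero hX e => exact h.mem_of_iso hX e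

lemma of_subset (h : ωω ⊆ XX) {n : ℕ} {M : C} (hM : HasResolutionLength ωω n M) :
    HasResolutionLength XX n M := by
  induction hM with
  | zero hX e => exact .zero (h hX) e
  | succ K X hX i p hse _ ih => exact .succ K X (h hX) i p hse ih

lemma subsingleton_ext [HasExt.{w} C] (hinj : IsRelInjective XX ωω) {n : ℕ} {M : C}
    (hM : HasResolutionLength ωω n M) {X : C} (hX : X ∈ XX) {i : ℕ} (hi : 0 < i) :
    Subsingleton (Abelian.Ext.{w} X M i) := by
  induction hM generalizing i with
  | zero hW e =>
    have := hinj _ hW X hX i hi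
    refine subsingleton_of_forall_eq 0 fun x => ?_
    rw [← Abelian.Ext.comp_mk₀_id x, ← e.inv_hom_id, ← Abelian.Ext.mk₀_comp_mk₀,
      ← Abelian.Ext.comp_assoc_of_second_deg_zero,
      Subsingleton.elim (x.comp (Abelian.Ext.mk₀ e.inv) (add_zero i)) 0, Abelian.Ext.zero_comp]
  | succ K W hW j p hse _ ih =>
    obtain ⟨w, hS⟩ := hse
    have := hinj _ hW X hX i hi
    have := ih (Nat.succ_pos i)
    refine subsingleton_of_forall_eq 0 fun x => ?_
    obtain ⟨y, rfl⟩ := Abelian.Ext.covariant_sequence_exact₃ X hS x rfl (Subsingleton.elim _ _)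
    rw [Subsingleton.elim y 0, Abelian.Ext.zero_comp]

/-- Every object with an `XX`-resolution of length `n` embeds into an object with an
`ωω`-resolution of length `n`, with cokernel in `XX`. -/
lemma exists_hull (hpre : IsPreresolving XX) (hcog : IsRelCogenerator XX ωω) {n : ℕ} {M : C}
    (hM : HasResolutionLength XX n M) :
    ∃ (H Q : C) (i : M ⟶ H) (p : H ⟶ Q),
      IsShortExactSeq i p ∧ HasResolutionLength ωω n H ∧ Q ∈ XX := by
  induction hM with
  | zero hX e =>
    obtain ⟨W, Q, i, p, hW, hQ, hse⟩ := hcog.2 _ (hpre.mem_of_iso hX e)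
    exact ⟨W, Q, i, p, hse, of_mem hW, hQ⟩
  | succ K X hX i p hse _ ih =>
    obtain ⟨H, Q, j, q, hjq, hH, hQ⟩ := ih
    obtain ⟨E, a, b, c, d, hab, hcd⟩ := hse.exists_pushout hjq
    obtain ⟨W, Q', i', p', hW, hQ', hse'⟩ := hcog.2 E (hpre.1 c d hcd hX hQ)
    obtain ⟨H', b', c', d', h₁, h₂⟩ := hab.exists_cokernel_comp hse'
    exact ⟨H', Q', c', d', h₂, .succ H W hW _ b' h₁ hH, hQ'⟩

lemma kernel (hpre : IsPreresolving XX) {n : ℕ} {A B D : C} {f : A ⟶ B} {g : B ⟶ D}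
    (h : IsShortExactSeq f g) (hB : HasResolutionLength XX n B) (hD : D ∈ XX) :
    HasResolutionLength XX n A := by
  cases hB with
  | zero hX e => exact of_mem (hpre.2 f g h (hpre.mem_of_iso hX e) hD)
  | succ K X hX i p hse hK =>
    obtain ⟨L, a, c, d, h₁, h₂⟩ := h.exists_kernel_comp hse
    exact .succ K L (hpre.2 _ _ h₁ hX hD) c d h₂ hK

lemma extension [HasExt.{w} C] (hpre : IsPreresolving XX) (hinj : IsRelInjective XX ωω)
    (hcog : IsRelCogenerator XX ωω) {n : ℕ} {A B D : C} {f : A ⟶ B} {g : B ⟶ D}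
    (h : IsShortExactSeq f g) (hA : HasResolutionLength XX n A) (hD : D ∈ XX) :
    HasResolutionLength XX n B := by
  obtain ⟨H, Q, i, p, hse, hH, hQ⟩ := hA.exists_hull hpre hcog
  obtain ⟨P, a, b, c, d, hab, hcd⟩ := h.exists_pushout hse
  refine kernel hpre hcd ?_ hQ
  obtain ⟨s, hs⟩ := hab.exists_section (hH.subsingleton_ext hinj hD Nat.one_pos)
  cases hH with
  | zero hW e =>
    exact of_mem (hpre.1 a b hab (hpre.mem_of_iso (hcog.1 hW) e) hD)
  | succ K W hW j q hjq hK =>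
    exact .succ K _ (hpre.biprod_mem (hcog.1 hW) hD) _ _ (hab.biprod_desc hs hjq)
      (hK.of_subset hcog.1)

/-- The kernel of every cover of an object with a resolution of length `n + 1` has a
resolution of length `n`. -/
lemma kernel_of_succ [HasExt.{w} C] (hpre : IsPreresolving XX) (hinj : IsRelInjective XX ωω)
    (hcog : IsRelCogenerator XX ωω) {n : ℕ} {K X M : C} {k : K ⟶ X} {p : X ⟶ M}
    (h : IsShortExactSeq k p) (hM : HasResolutionLength XX (n + 1) M) (hX : X ∈ XX) :
    HasResolutionLength XX n K := by
  cases hM with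
  | succ L Y hY i q hse hL =>
    obtain ⟨P, a, b, c, d, hab, hcd⟩ := hse.exists_pullback h
    exact kernel hpre hcd (extension hpre hinj hcog hab hL hX) hY

lemma retract [HasExt.{w} C] (hpre : IsPreresolving XX) (hinj : IsRelInjective XX ωω)
    (hcog : IsRelCogenerator XX ωω) (hsum : ClosedUnderSummands XX) {n : ℕ} {M N : C}
    (hM : HasResolutionLength XX n M) {s : N ⟶ M} {r : M ⟶ N} (hsr : s ≫ r = 𝟙 N) :
    HasResolutionLength XX n N := by
  induction n generalizing M N with
  | zero => exact of_mem (hsum (hM.mem hpre) s r hsr)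
  | succ n ih =>
    have hM' := hM
    cases hM with
    | succ K X hX i p hse hK =>
      obtain ⟨L, L', a, b, a', b', s', r', h₁, h₂, h₃⟩ := hse.exists_cover_of_retract hsr
      exact .succ L X hX a b h₁
        (ih (kernel_of_succ hpre hinj hcog h₂ hM' (hpre.biprod_mem hX hX)) h₃)

end HasResolutionLength

lemma subset_resHat : XX ⊆ resHat XX := fun _ hX => ⟨0, .of_mem hX⟩

lemma mem_resHat_of_cover {K X M : C} {k : K ⟶ X} {p : X ⟶ M} (h : IsShortExactSeq k p)
    (hX : X ∈ XX) (hK : K ∈ resHat XX) : M ∈ resHat XX :=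
  ⟨_, .succ K X hX k p h hK.choose_spec⟩

lemma IsPreresolving.exists_cover (hpre : IsPreresolving XX) {M : C} (hM : M ∈ resHat XX) :
    ∃ (K X : C) (k : K ⟶ X) (p : X ⟶ M),
      IsShortExactSeq k p ∧ X ∈ XX ∧ K ∈ resHat XX := by
  obtain ⟨n, hM⟩ := hM
  cases hM with
  | zero hX e =>
    have hM := hpre.mem_of_iso hX e
    exact ⟨0, M, 0, 𝟙 M, .zero_left M, hM, subset_resHat (hpre.zero_mem hM)⟩
  | succ K X hX i p hse hK => exact ⟨K, X, i, p, hse, hX, _, hK⟩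

lemma closedUnderExtensions_resHat [HasExt.{w} C] (hpre : IsPreresolving XX) (hinj : IsRelInjective XX ωω)
    (hcog : IsRelCogenerator XX ωω) : ClosedUnderExtensions (resHat XX) := by
  intro A B D f g h hA ⟨n, hD⟩
  induction hD generalizing A B with
  | zero hX e => exact ⟨_, hA.choose_spec.extension hpre hinj hcog h (hpre.mem_of_iso hX e)⟩
  | succ K X hX i p hse _ ih =>
    obtain ⟨P, a, b, c, d, hab, hcd⟩ := h.exists_pullback hse
    have hP : P ∈ resHat XX := ⟨_, hA.choose_spec.extension hpre hinj hcog hab hX⟩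
    obtain ⟨L, Y, k, q, hkq, hY, hL⟩ := hpre.exists_cover hP
    obtain ⟨L', a', c', d', h₁, h₂⟩ := hcd.exists_kernel_comp hkq
    exact mem_resHat_of_cover h₁ hY (ih c' d' h₂ hL)

lemma closedUnderKernelsOfEpis_resHat [HasExt.{w} C] (hpre : IsPreresolving XX) (hinj : IsRelInjective XX ωω)
    (hcog : IsRelCogenerator XX ωω) : ClosedUnderKernelsOfEpis (resHat XX) := by
  intro A B D f g h hB hD
  obtain ⟨K, X, k, p, hse, hX, hK⟩ := hpre.exists_cover hD
  obtain ⟨P, a, b, c, d, hab, hcd⟩ := h.exists_pullback hse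
  obtain ⟨n, hP⟩ := closedUnderExtensions_resHat hpre hinj hcog c d hcd hK hB
  exact ⟨n, hP.kernel hpre hab hX⟩

lemma closedUnderCokernelsOfMonos_resHat [HasExt.{w} C] (hpre : IsPreresolving XX)
    (hinj : IsRelInjective XX ωω) (hcog : IsRelCogenerator XX ωω) :
    ClosedUnderCokernelsOfMonos (resHat XX) := by
  intro A B D f g h hA hB
  obtain ⟨K, X, k, p, hse, hX, hK⟩ := hpre.exists_cover hB
  obtain ⟨L, a, c, d, h₁, h₂⟩ := h.exists_kernel_comp hse
  exact mem_resHat_of_cover h₁ hX (closedUnderExtensions_resHat hpre hinj hcog c d h₂ hK hA)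

lemma resHat_subset {T : Set C} (hpre : IsPreresolving T) (hco : IsPrecoresolving T)
    (h : XX ⊆ T) : resHat XX ⊆ T := by
  rintro M ⟨n, hM⟩
  induction hM with
  | zero hX e => exact hpre.mem_of_iso (h hX) e
  | succ K X hX i p hse _ ih => exact hco.2 i p hse ih (h hX)

end

/-- Theorem AB9. If `X` is pre-resolving and `ω` is an `X`-injective
relative cogenerator in `X`, then (a) `X^∧` is the smallest pre-resolving and
pre-coresolving class containing `X`; (b) if moreover `X` and `ω` are closed under
direct summands, then `X^∧` is closed under direct summands. In particular, if
`(X,ω)` is a left Frobenius pair, then `X^∧` is the smallest thick class containing `X`. -/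
theorem stmt6 (XX ωω : Set C) (hpre : IsPreresolving XX)
    (hinj : IsRelInjective XX ωω) (hcog : IsRelCogenerator XX ωω) :
    (IsPreresolving (resHat XX) ∧ IsPrecoresolving (resHat XX) ∧ XX ⊆ resHat XX ∧
      ∀ T : Set C, IsPreresolving T → IsPrecoresolving T → XX ⊆ T → resHat XX ⊆ T) ∧
    ((ClosedUnderSummands XX ∧ ClosedUnderSummands ωω) →
      ClosedUnderSummands (resHat XX)) ∧
    (LeftFrobeniusPair XX ωω → resHat XX = thickClosure XX) := by
  have hext := closedUnderExtensions_resHat hpre hinj hcog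
  have hres : IsPreresolving (resHat XX) :=
    ⟨hext, closedUnderKernelsOfEpis_resHat hpre hinj hcog⟩
  have hcores : IsPrecoresolving (resHat XX) :=
    ⟨hext, closedUnderCokernelsOfMonos_resHat hpre hinj hcog⟩
  have hsum (h : ClosedUnderSummands XX) : ClosedUnderSummands (resHat XX) :=
    fun _ _ hM _ _ hsr => ⟨_, hM.choose_spec.retract hpre hinj hcog h hsr⟩
  refine ⟨⟨hres, hcores, subset_resHat, fun T h₁ h₂ h₃ => resHat_subset h₁ h₂ h₃⟩,
    fun h => hsum h.1, fun h => Set.Subset.antisymm ?_ ?_⟩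
  · exact Set.subset_sInter fun T hT => resHat_subset hT.1.1.1 hT.1.2.1 hT.2
  · have hs := hsum h.leftThick.2
    exact Set.sInter_subset_of_mem ⟨⟨⟨hres, hs⟩, ⟨hcores, hs⟩⟩, subset_resHat⟩

end ABFormal
end
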